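/- arXiv:2405.08706 — 3 statements merged into one kernel-verified Lean document; each statement's English description precedes it below -/
import Mathlib

section
/- Let σ > 0, ε > 0, and let X ~ N(0, σ²). Then E[X² · 1{X² > ε}] ≤ (σ² + ε/2 + √(ε²/4 + ε σ²)) · P(X² > ε). Equivalently, E[X² | X² > ε] ≤ σ² + ε/2 + √(ε²/4 + ε σ²). -/
open MeasureTheory ProbabilityTheory

section GaussianTail

open Set Filter Topology

lemma hasDerivAt_exp_neg_sq_div (s x : ℝ) :
    HasDerivAt (fun y : ℝ => Real.exp (-y ^ 2 / (2 * s)))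
      (-(x / s) * Real.exp (-x ^ 2 / (2 * s))) x := by
  have h := (((hasDerivAt_pow 2 x).neg).div_const (2 * s)).exp
  refine h.congr_deriv ?_
  simp only [Pi.neg_apply, Nat.cast_ofNat, Nat.add_one_sub_one, pow_one]
  rw [show -(2 * x) / (2 * s) = -(x / s) by rw [neg_div, mul_div_mul_left _ _ two_ne_zero]]
  ring

lemma integrable_exp_neg_sq_div {s : ℝ} (hs : 0 < s) :
    Integrable fun x : ℝ => Real.exp (-x ^ 2 / (2 * s)) := by
  refine (integrable_exp_neg_mul_sq (b := 1 / (2 * s)) (by positivity)).congr (ae_of_all _ ?_)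
  intro x
  ring_nf

lemma integrable_sq_mul_exp_neg_sq_div {s : ℝ} (hs : 0 < s) :
    Integrable fun x : ℝ => x ^ 2 * Real.exp (-x ^ 2 / (2 * s)) := by
  refine (integrable_rpow_mul_exp_neg_mul_sq (b := 1 / (2 * s)) (s := 2) (by positivity)
    (by norm_num)).congr (ae_of_all _ ?_)
  intro x
  simp only [Real.rpow_ofNat]
  ring_nf

lemma tendsto_mul_exp_neg_sq_div_atTop {s : ℝ} (hs : 0 < s) :
    Tendsto (fun x : ℝ => x * Real.exp (-x ^ 2 / (2 * s))) atTop (𝓝 0) := by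
  have hexp := integrable_exp_neg_sq_div hs
  have hsq := integrable_sq_mul_exp_neg_sq_div hs
  refine tendsto_zero_of_hasDerivAt_of_integrableOn_Ioi (a := 0)
    (f' := fun x => Real.exp (-x ^ 2 / (2 * s))
      - (1 / s) * (x ^ 2 * Real.exp (-x ^ 2 / (2 * s)))) ?_
    (hexp.sub (hsq.const_mul _)).integrableOn ?_
  · intro x _
    refine ((hasDerivAt_id x).mul (hasDerivAt_exp_neg_sq_div s x)).congr_deriv ?_
    simp only [id]
    ring
  · refine Integrable.integrableOn ?_
    refine (integrable_mul_exp_neg_mul_sq (b := 1 / (2 * s)) (by positivity)).congr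
      (ae_of_all _ ?_)
    intro x
    ring_nf

lemma integral_Ioi_sq_mul_exp_neg_sq_div {s : ℝ} (hs : 0 < s) (a : ℝ) :
    ∫ x in Ioi a, x ^ 2 * Real.exp (-x ^ 2 / (2 * s))
      = s * a * Real.exp (-a ^ 2 / (2 * s))
        + s * ∫ x in Ioi a, Real.exp (-x ^ 2 / (2 * s)) := by
  have hexp := (integrable_exp_neg_sq_div hs).integrableOn (s := Ioi a)
  have hsq := (integrable_sq_mul_exp_neg_sq_div hs).integrableOn (s := Ioi a)
  have hderiv : ∀ x ∈ Ici a, HasDerivAt (fun y => (-s) * (y * Real.exp (-y ^ 2 / (2 * s))))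
      (x ^ 2 * Real.exp (-x ^ 2 / (2 * s)) - s * Real.exp (-x ^ 2 / (2 * s))) x := by
    intro x _
    refine (((hasDerivAt_id x).mul (hasDerivAt_exp_neg_sq_div s x)).const_mul (-s)).congr_deriv ?_
    simp only [id]
    field_simp
    ring
  have h := integral_Ioi_of_hasDerivAt_of_tendsto' hderiv (hsq.sub (hexp.const_mul s))
    ((tendsto_mul_exp_neg_sq_div_atTop hs).const_mul (-s))
  rw [integral_sub hsq (hexp.const_mul s), integral_const_mul] at h
  linarith

/-- **Birnbaum's inequality**, a lower bound on the Gaussian tail. -/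
lemma birnbaum_le_integral_Ioi_exp_neg_sq_div {s a : ℝ} (hs : 0 < s) (ha : 0 ≤ a) :
    (√(a ^ 2 + 4 * s) - a) / 2 * Real.exp (-a ^ 2 / (2 * s))
      ≤ ∫ x in Ioi a, Real.exp (-x ^ 2 / (2 * s)) := by
  set g : ℝ → ℝ := fun x => (√(x ^ 2 + 4 * s) - x) / 2 * Real.exp (-x ^ 2 / (2 * s)) with hg
  set d : ℝ → ℝ := fun x => (√(x ^ 2 + 4 * s) - x) / (2 * s) * (x + s / √(x ^ 2 + 4 * s)) with hd
  have hR (x : ℝ) : 0 < √(x ^ 2 + 4 * s) := by positivity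
  have hR2 (x : ℝ) : √(x ^ 2 + 4 * s) ^ 2 = x ^ 2 + 4 * s := Real.sq_sqrt (by positivity)
  have hRx (x : ℝ) : x ≤ √(x ^ 2 + 4 * s) := Real.le_sqrt_of_sq_le (by linarith)
  have hderiv : ∀ x ∈ Ici a, HasDerivAt g (-(d x * Real.exp (-x ^ 2 / (2 * s)))) x := by
    intro x _
    have hsqrt := ((hasDerivAt_pow 2 x).add_const (4 * s)).sqrt (by positivity)
    refine (((hsqrt.sub (hasDerivAt_id x)).div_const 2).mul
      (hasDerivAt_exp_neg_sq_div s x)).congr_deriv ?_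
    have := (hR x).ne'
    simp only [hd, id, Pi.sub_apply, Nat.cast_ofNat, Nat.add_one_sub_one, pow_one]
    field_simp
    ring
  have hd_nonneg : ∀ x ∈ Ioi a, 0 ≤ d x := by
    intro x hx
    have hx0 : 0 ≤ x := ha.trans (le_of_lt hx)
    have h1 : 0 ≤ √(x ^ 2 + 4 * s) - x := sub_nonneg.2 (hRx x)
    simp only [hd]
    positivity
  have hd_le (x : ℝ) : d x ≤ 1 := by
    have h1 := hR x
    have h2 := hR2 x
    simp only [hd]
    rw [show (√(x ^ 2 + 4 * s) - x) / (2 * s) * (x + s / √(x ^ 2 + 4 * s))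
      = ((√(x ^ 2 + 4 * s) - x) * (x * √(x ^ 2 + 4 * s) + s)) / (2 * s * √(x ^ 2 + 4 * s)) by
        field_simp, div_le_one (by positivity)]
    generalize √(x ^ 2 + 4 * s) = r at *
    obtain rfl : s = (r ^ 2 - x ^ 2) / 4 := by linarith
    have h3 : 0 ≤ r - x :=
      sub_nonneg.2 (abs_lt_of_sq_lt_sq' (show x ^ 2 < r ^ 2 by linarith) h1.le).2.le
    nlinarith [pow_nonneg h3 3]
  have hlim : Tendsto g atTop (𝓝 0) := by
    refine squeeze_zero' (g := fun x => 2 * s * (x * Real.exp (-x ^ 2 / (2 * s)))) ?_ ?_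
      (by simpa using (tendsto_mul_exp_neg_sq_div_atTop hs).const_mul (2 * s))
    · refine Eventually.of_forall fun x => ?_
      have h1 : 0 ≤ √(x ^ 2 + 4 * s) - x := sub_nonneg.2 (hRx x)
      simp only [hg]
      positivity
    · filter_upwards [eventually_ge_atTop (1 : ℝ)] with x hx
      simp only [hg]
      rw [← mul_assoc]
      gcongr
      have : √(x ^ 2 + 4 * s) ≤ x + 4 * s * x := by
        refine Real.sqrt_le_iff.2 ⟨by positivity, ?_⟩
        nlinarith [mul_nonneg hs.le (show 0 ≤ x ^ 2 - 1 by nlinarith), sq_nonneg (s * x)]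
      linarith
  have hnonpos : ∀ x ∈ Ioi a, -(d x * Real.exp (-x ^ 2 / (2 * s))) ≤ 0 := fun x hx =>
    neg_nonpos.2 (mul_nonneg (hd_nonneg x hx) (Real.exp_pos _).le)
  have hint := integrableOn_Ioi_deriv_of_nonpos' hderiv hnonpos hlim
  have h := integral_Ioi_of_hasDerivAt_of_nonpos' hderiv hnonpos hlim
  rw [integral_neg] at h
  have hle : ∫ x in Ioi a, d x * Real.exp (-x ^ 2 / (2 * s))
      ≤ ∫ x in Ioi a, Real.exp (-x ^ 2 / (2 * s)) := by
    refine setIntegral_mono_on (by simpa using hint.neg)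
      (integrable_exp_neg_sq_div hs).integrableOn measurableSet_Ioi fun x _ => ?_
    exact mul_le_of_le_one_left (Real.exp_pos _).le (hd_le x)
  change g a ≤ _
  linarith

lemma integral_Ioi_sq_mul_exp_neg_sq_div_le {s a : ℝ} (hs : 0 < s) (ha : 0 ≤ a) :
    ∫ x in Ioi a, x ^ 2 * Real.exp (-x ^ 2 / (2 * s))
      ≤ (s + a * (a + √(a ^ 2 + 4 * s)) / 2) * ∫ x in Ioi a, Real.exp (-x ^ 2 / (2 * s)) := by
  rw [integral_Ioi_sq_mul_exp_neg_sq_div hs]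
  have h := birnbaum_le_integral_Ioi_exp_neg_sq_div hs ha
  have hR2 : √(a ^ 2 + 4 * s) ^ 2 = a ^ 2 + 4 * s := Real.sq_sqrt (by positivity)
  have hc : 0 ≤ a * (a + √(a ^ 2 + 4 * s)) / 2 := by positivity
  have h' := mul_le_mul_of_nonneg_left h hc
  have : a * (a + √(a ^ 2 + 4 * s)) / 2
      * ((√(a ^ 2 + 4 * s) - a) / 2 * Real.exp (-a ^ 2 / (2 * s)))
      = s * a * Real.exp (-a ^ 2 / (2 * s)) := by
    linear_combination a * Real.exp (-a ^ 2 / (2 * s)) / 4 * hR2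
  linarith

lemma setIntegral_lt_sq_gaussianReal {v : NNReal} (hv : v ≠ 0) (ε : ℝ) (f : ℝ → ℝ) :
    ∫ x in {x : ℝ | ε < x ^ 2}, f (x ^ 2) ∂(gaussianReal 0 v)
      = 2 * (√(2 * Real.pi * v))⁻¹
        * ∫ x in Ioi √ε, f (x ^ 2) * Real.exp (-x ^ 2 / (2 * v)) := by
  have hm : MeasurableSet {x : ℝ | ε < x ^ 2} := measurableSet_lt (by fun_prop) (by fun_prop)
  have hset : Ioi 0 ∩ {x : ℝ | ε < x ^ 2} = Ioi √ε := by
    ext x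
    simp only [mem_inter_iff, mem_Ioi, mem_ofPred_eq]
    constructor
    · rintro ⟨h0, h⟩
      exact (Real.sqrt_lt' h0).2 h
    · intro h
      have h0 := (Real.sqrt_nonneg ε).trans_lt h
      exact ⟨h0, (Real.sqrt_lt' h0).1 h⟩
  set F : ℝ → ℝ := {x : ℝ | ε < x ^ 2}.indicator
    fun x => (√(2 * Real.pi * v))⁻¹ * (f (x ^ 2) * Real.exp (-x ^ 2 / (2 * v))) with hF
  have habs (x : ℝ) : F |x| = F x := by simp [hF, indicator]
  rw [← integral_indicator hm, integral_gaussianReal_eq_integral_smul hv]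
  calc _ = ∫ x, F |x| := by
        refine integral_congr_ae (ae_of_all _ fun x => ?_)
        beta_reduce
        rw [habs]
        simp only [hF, indicator, gaussianPDFReal, smul_eq_mul, sub_zero]
        split_ifs
        · ring
        · simp
    _ = 2 * ∫ x in Ioi 0, F x := integral_comp_abs
    _ = _ := by
        rw [hF, setIntegral_indicator hm, hset, integral_const_mul, ← mul_assoc 2 (_⁻¹)]

end GaussianTail

/-- Mills-ratio-type bound on the truncated Gaussian second moment:
for X ~ N(0, σ²) and ε > 0,
E[X² · 1{X² > ε}] ≤ (σ² + ε/2 + √(ε²/4 + ε σ²)) · P(X² > ε). -/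
theorem truncated_gaussian_second_moment_upper_bound
    {Ω : Type*} [MeasurableSpace Ω] (μ : Measure Ω) [IsProbabilityMeasure μ]
    (σ ε : ℝ) (hσ : 0 < σ) (hε : 0 < ε)
    (X : Ω → ℝ) (hX : Measurable X)
    (hlaw : μ.map X = gaussianReal 0 (σ ^ 2).toNNReal) :
    ∫ ω, Set.indicator {ω | ε < (X ω) ^ 2} (fun ω => (X ω) ^ 2) ω ∂μ
      ≤ (σ ^ 2 + ε / 2 + Real.sqrt (ε ^ 2 / 4 + ε * σ ^ 2))
          * (μ {ω | ε < (X ω) ^ 2}).toReal := by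
  have hs : 0 < σ ^ 2 := by positivity
  have hv : (σ ^ 2).toNNReal ≠ 0 := (Real.toNNReal_pos.2 hs).ne'
  have hm : MeasurableSet {x : ℝ | ε < x ^ 2} := measurableSet_lt (by fun_prop) (by fun_prop)
  have hmoment : ∫ ω, Set.indicator {ω | ε < (X ω) ^ 2} (fun ω => (X ω) ^ 2) ω ∂μ
      = ∫ x in {x : ℝ | ε < x ^ 2}, x ^ 2 ∂(gaussianReal 0 (σ ^ 2).toNNReal) := by
    rw [← hlaw, setIntegral_map hm (by fun_prop) hX.aemeasurable, ← integral_indicator (hX hm)]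
    rfl
  have hprob : (μ {ω | ε < (X ω) ^ 2}).toReal
      = ∫ _ in {x : ℝ | ε < x ^ 2}, (1 : ℝ) ∂(gaussianReal 0 (σ ^ 2).toNNReal) := by
    rw [← hlaw, setIntegral_const, smul_eq_mul, mul_one, map_measureReal_apply hX hm]
    rfl
  have hconst : √ε * (√ε + √(√ε ^ 2 + 4 * σ ^ 2)) / 2 = ε / 2 + √(ε ^ 2 / 4 + ε * σ ^ 2) := by
    rw [Real.sq_sqrt hε.le, mul_add, Real.mul_self_sqrt hε.le, ← Real.sqrt_mul hε.le,
      show ε * (ε + 4 * σ ^ 2) = 2 ^ 2 * (ε ^ 2 / 4 + ε * σ ^ 2) by ring,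
      Real.sqrt_mul (by positivity), Real.sqrt_sq zero_le_two]
    ring
  have h := integral_Ioi_sq_mul_exp_neg_sq_div_le hs (Real.sqrt_nonneg ε)
  rw [hconst, ← add_assoc] at h
  rw [hmoment, hprob, setIntegral_lt_sq_gaussianReal hv ε (fun y => y),
    setIntegral_lt_sq_gaussianReal hv ε (fun _ => 1), Real.coe_toNNReal _ hs.le]
  simp only [one_mul]
  rw [mul_left_comm]
  gcongr
end

section
/- Let θ ∈ (0,1), ε̂ > 0, σ_i ≥ 0, σ_0 > 0. Set s := ((1−θ)/(1+θ)) σ_i², and assume ε̂² > (1−θ)² σ_i², σ_0² > s, and N := ε̂² − θ ε̂ √(ε̂² − (1−θ)² σ_i²) − s > 0. Then for every natural number l, the variance σ_l² := θ^{2l} σ_0² + s (1 − θ^{2l}) satisfies σ_l² ≤ (√(ε̂² − (1−θ)² σ_i²)/θ − ε̂/2)² − ε̂²/4 if and only if l ≥ (1/(2 ln θ)) · ln( N / (θ² (σ_0² − s)) ). -/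
/-- For `0 < θ < 1` and `X > 0`, the inequality `θ ^ (2 * l) ≤ X` is a lower bound on `l`. -/
theorem pow_two_mul_le_iff_ge_log {θ X : ℝ} (hθ0 : 0 < θ) (hθ1 : θ < 1) (hX : 0 < X) (l : ℕ) :
    θ ^ (2 * l) ≤ X ↔ (l : ℝ) ≥ 1 / (2 * Real.log θ) * Real.log X := by
  have hlog : 2 * Real.log θ < 0 := by linarith [Real.log_neg hθ0 hθ1]
  rw [← Real.log_le_log_iff (by positivity) hX, Real.log_pow, ge_iff_le, one_div_mul_eq_div,
    div_le_iff_of_neg hlog]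
  push_cast
  ring_nf

/-- Corollary 1: with s = ((1−θ)/(1+θ)) σ_i² and
N = ε̂² − θ ε̂ √(ε̂² − (1−θ)² σ_i²) − s > 0, the variance
σ_l² = θ^{2l} σ_0² + s(1 − θ^{2l}) satisfies the feasibility bound
iff l ≥ (1/(2 ln θ)) ln(N / (θ² (σ_0² − s))). -/
theorem recovery_time_lower_bound
    (θ εhat σi σ0 : ℝ) (hθ : θ ∈ Set.Ioo (0 : ℝ) 1) (hεhat : 0 < εhat)
    (hσi : 0 ≤ σi) (hσ0 : 0 < σ0)
    (s : ℝ) (hs : s = (1 - θ) / (1 + θ) * σi ^ 2)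
    (h1 : εhat ^ 2 > (1 - θ) ^ 2 * σi ^ 2)
    (h2 : σ0 ^ 2 > s)
    (N : ℝ)
    (hN : N = εhat ^ 2 - θ * εhat * Real.sqrt (εhat ^ 2 - (1 - θ) ^ 2 * σi ^ 2) - s)
    (hNpos : 0 < N) :
    ∀ l : ℕ,
      θ ^ (2 * l) * σ0 ^ 2 + s * (1 - θ ^ (2 * l))
          ≤ (Real.sqrt (εhat ^ 2 - (1 - θ) ^ 2 * σi ^ 2) / θ - εhat / 2) ^ 2
            - εhat ^ 2 / 4
        ↔ (l : ℝ) ≥ 1 / (2 * Real.log θ) * Real.log (N / (θ ^ 2 * (σ0 ^ 2 - s))) := by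
  intro l
  obtain ⟨hθ0, hθ1⟩ := hθ
  have hd : 0 < σ0 ^ 2 - s := sub_pos.mpr h2
  have hsq := Real.sq_sqrt (sub_pos.mpr h1).le
  have hs' : (1 - θ) ^ 2 * σi ^ 2 = s * (1 - θ ^ 2) := by
    have : 1 + θ ≠ 0 := by positivity
    rw [hs]
    field_simp
    ring
  set r := Real.sqrt (εhat ^ 2 - (1 - θ) ^ 2 * σi ^ 2)
  have hbound : (r / θ - εhat / 2) ^ 2 - εhat ^ 2 / 4 = N / θ ^ 2 + s := by
    rw [hN]
    field_simp
    linear_combination 16 * hsq - 16 * hs'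
  have hvar : θ ^ (2 * l) * σ0 ^ 2 + s * (1 - θ ^ (2 * l))
      = θ ^ (2 * l) * (σ0 ^ 2 - s) + s := by ring
  rw [hbound, hvar, add_le_add_iff_right, ← le_div_iff₀ hd, div_div]
  exact pow_two_mul_le_iff_ge_log hθ0 hθ1 (by positivity) l
end

section
/- Let a < 0, V > 0, X > 0, Δt > 0 with Δt ≤ −V/a, and set t_m − t_0 = −V/a. Define the relative acceleration δ(s) = a · 1{t_0 ≤ s < t_m} − a · 1{t_0 + Δt ≤ s < t_m + Δt} and the relative distance D(t) = X + ∫_{t_0}^t ∫_{t_0}^u δ(s) ds du. Then: (i) for t_0 ≤ t < t_0 + Δt, D(t) = X + (a/2)(t − t_0)²; (ii) for t_0 + Δt ≤ t < t_m, D(t) = X + aΔt(t − t_0) − (a/2)Δt²; (iii) for t_m ≤ t ≤ t_m + Δt, D(t) = X + aΔt(t_m − t_0) − (a/2)Δt² + aΔt(t − t_m) − (a/2)(t − t_m)². -/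
open MeasureTheory Set

/-- Integrating a function cut off to `[c, ∞)` from a point left of `c`. -/
theorem intervalIntegral_indicator_Ici {b c u : ℝ} (hbc : b ≤ c) (hbu : b ≤ u) (f : ℝ → ℝ) :
    ∫ s in b..u, (Ici c).indicator f s = ∫ s in c..max c u, f s := by
  have hset : Ioc b u ∩ Ioi c = Ioc c (max c u) := by
    ext x
    simp only [mem_inter_iff, mem_Ioc, mem_Ioi, le_max_iff]
    grind
  rw [intervalIntegral.integral_of_le hbu, intervalIntegral.integral_of_le (le_max_left c u),
    ← hset, ← setIntegral_indicator measurableSet_Ioi]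
  exact integral_congr_ae
    (ae_restrict_of_ae (indicator_ae_eq_of_ae_eq_set Ioi_ae_eq_Ici.symm))

theorem intervalIntegrable_indicator_Ici_one (b c u : ℝ) :
    IntervalIntegrable ((Ici c).indicator fun _ => (1 : ℝ)) volume b u := by
  rw [intervalIntegrable_iff]
  exact (intervalIntegrable_iff.1 intervalIntegrable_const).indicator measurableSet_Ici

theorem indicator_Ico_eq_sub {c d : ℝ} (hcd : c ≤ d) (s : ℝ) :
    (Ico c d).indicator (fun _ => (1 : ℝ)) s =
      (Ici c).indicator (fun _ => 1) s - (Ici d).indicator (fun _ => 1) s := by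
  simp only [indicator_apply, mem_Ico, mem_Ici]
  grind

theorem intervalIntegral_max_sub {b c t : ℝ} (hbc : b ≤ c) (hbt : b ≤ t) :
    ∫ u in b..t, (max c u - c) = (max c t - c) ^ 2 / 2 := by
  have hramp : (fun u => max c u - c) = (Ici c).indicator fun u => u - c := by
    ext u
    simp only [indicator_apply, mem_Ici]
    grind
  rw [hramp, intervalIntegral_indicator_Ici hbc hbt,
    intervalIntegral.integral_comp_sub_right (fun x => x) c, integral_id]
  ring

/-- The double integral of a combination of two unit pulses. -/
theorem intervalIntegral_intervalIntegral_pulses {a b c d e f t : ℝ} (hbc : b ≤ c) (hcd : c ≤ d)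
    (hbe : b ≤ e) (hef : e ≤ f) (hbt : b ≤ t) :
    ∫ u in b..t, ∫ s in b..u, (a * (Ico c d).indicator (fun _ => (1 : ℝ)) s -
        a * (Ico e f).indicator (fun _ => (1 : ℝ)) s) =
      a / 2 * ((max c t - c) ^ 2 - (max d t - d) ^ 2 -
        ((max e t - e) ^ 2 - (max f t - f) ^ 2)) := by
  have hinner : ∀ u ∈ uIcc b t, ∫ s in b..u, (a * (Ico c d).indicator (fun _ => (1 : ℝ)) s -
        a * (Ico e f).indicator (fun _ => (1 : ℝ)) s) =
      a * ((max c u - c) - (max d u - d) - ((max e u - e) - (max f u - f))) := by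
    intro u hu
    rw [uIcc_of_le hbt] at hu
    have hi := fun x => intervalIntegrable_indicator_Ici_one b x u
    have hval : ∀ x, b ≤ x →
        ∫ s in b..u, (Ici x).indicator (fun _ => (1 : ℝ)) s = max x u - x := by
      intro x hx
      simp [intervalIntegral_indicator_Ici hx hu.1]
    simp only [indicator_Ico_eq_sub hcd, indicator_Ico_eq_sub hef, ← mul_sub]
    rw [intervalIntegral.integral_const_mul,
      intervalIntegral.integral_sub ((hi c).sub (hi d)) ((hi e).sub (hi f)),
      intervalIntegral.integral_sub (hi c) (hi d), intervalIntegral.integral_sub (hi e) (hi f),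
      hval c hbc, hval d (hbc.trans hcd), hval e hbe, hval f (hbe.trans hef)]
  have hi : ∀ x, IntervalIntegrable (fun u => max x u - x) volume b t := fun x =>
    Continuous.intervalIntegrable (by fun_prop) b t
  rw [intervalIntegral.integral_congr hinner, intervalIntegral.integral_const_mul,
    intervalIntegral.integral_sub ((hi c).sub (hi d)) ((hi e).sub (hi f)),
    intervalIntegral.integral_sub (hi c) (hi d), intervalIntegral.integral_sub (hi e) (hi f),
    intervalIntegral_max_sub hbc hbt, intervalIntegral_max_sub (hbc.trans hcd) hbt,
    intervalIntegral_max_sub hbe hbt, intervalIntegral_max_sub (hbe.trans hef) hbt]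
  ring

/-- piecewise relative distance, eq. (5): with relative
acceleration δ(s) = a·1_{[t0, tm)}(s) − a·1_{[t0+Δt, tm+Δt)}(s) and
D(t) = X + ∫_{t0}^t ∫_{t0}^u δ(s) ds du, the three-regime formula holds. -/
theorem piecewise_relative_distance
    (a V X Δt t0 tm : ℝ)
    (ha : a < 0) (hV : 0 < V) (hX : 0 < X) (hΔt : 0 < Δt)
    (hΔt_le : Δt ≤ -V / a) (htm : tm - t0 = -V / a)
    (δ : ℝ → ℝ)
    (hδ : δ = fun s =>
      a * Set.indicator (Set.Ico t0 tm) (fun _ => (1 : ℝ)) s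
        - a * Set.indicator (Set.Ico (t0 + Δt) (tm + Δt)) (fun _ => (1 : ℝ)) s)
    (D : ℝ → ℝ)
    (hD : D = fun t => X + ∫ u in t0..t, ∫ s in t0..u, δ s) :
    (∀ t, t0 ≤ t → t < t0 + Δt → D t = X + a / 2 * (t - t0) ^ 2)
      ∧ (∀ t, t0 + Δt ≤ t → t < tm →
          D t = X + a * Δt * (t - t0) - a / 2 * Δt ^ 2)
      ∧ (∀ t, tm ≤ t → t ≤ tm + Δt →
          D t = X + a * Δt * (tm - t0) - a / 2 * Δt ^ 2
            + a * Δt * (t - tm) - a / 2 * (t - tm) ^ 2) := by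
  have hle : t0 + Δt ≤ tm := by linarith
  have hD_eq : ∀ t, t0 ≤ t → D t = X + a / 2 * ((max t0 t - t0) ^ 2 - (max tm t - tm) ^ 2 -
      ((max (t0 + Δt) t - (t0 + Δt)) ^ 2 - (max (tm + Δt) t - (tm + Δt)) ^ 2)) := by
    intro t ht
    simp only [hD, hδ]
    rw [intervalIntegral_intervalIntegral_pulses le_rfl (by linarith) (by linarith)
      (by linarith) ht]
  refine ⟨fun t h₁ h₂ => ?_, fun t h₁ h₂ => ?_, fun t h₁ h₂ => ?_⟩
  · rw [hD_eq t h₁, max_eq_right h₁, max_eq_left (by linarith : t ≤ tm), max_eq_left h₂.le,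
      max_eq_left (by linarith : t ≤ tm + Δt)]
    ring
  · rw [hD_eq t (by linarith), max_eq_right (by linarith : t0 ≤ t), max_eq_left h₂.le,
      max_eq_right h₁, max_eq_left (by linarith : t ≤ tm + Δt)]
    ring
  · rw [hD_eq t (by linarith), max_eq_right (by linarith : t0 ≤ t), max_eq_right h₁,
      max_eq_right (by linarith : t0 + Δt ≤ t), max_eq_left h₂]
    ring
end
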